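/- Let g be a finite-dimensional Lie algebra over a field K of characteristic 0, E = g × g* with the symmetric pairing ⟨(X,α),(Y,β)⟩ = α(Y) + β(X) and the Dorfman bracket [(X,α),(Y,β)] = ([X,Y], Z ↦ α([Y,Z]) − β([X,Z])). Let π be a Poisson bivector on g, ω a closed 2-form on g, and N := π∘ω♭ : g → g. Then (π,ω) is a PΩ structure on g (i.e., additionally the 2-form ω_N, ω_N(X,Y) = ω(NX,Y), is closed) if and only if (J_ω, J_N) is a compatible pair on E, i.e., J_ω∘J_N = −J_N∘J_ω and [u,v]_{J_ω,J_N} + [u,v]_{J_N,J_ω} = 0 for all u,v ∈ E. -/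

import Mathlib

open Module

set_option linter.unusedSectionVars false

variable {K : Type*} [Field K] [CharZero K]
variable {g : Type*} [LieRing g] [LieAlgebra K g] [FiniteDimensional K g]

/-- The adjoint action of `x` as a linear map `z ↦ ⁅x, z⁆`. -/
def adl (x : g) : g →ₗ[K] g where
  toFun z := ⁅x, z⁆
  map_add' a b := lie_add x a b
  map_smul' c a := lie_smul c x a

@[simp] lemma adl_apply (x z : g) : adl (K := K) x z = ⁅x, z⁆ := rfl

/-- The Dorfman bracket on `g × g*`:
`[(X,α),(Y,β)] = (⁅X,Y⁆, Z ↦ α ⁅Y,Z⁆ - β ⁅X,Z⁆)`. -/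
def dorf (u v : g × Dual K g) : g × Dual K g :=
  (⁅u.1, v.1⁆, u.2 ∘ₗ adl (K := K) v.1 - v.2 ∘ₗ adl (K := K) u.1)

/-- Torsion of an endomorphism of `g × g*` with respect to the Dorfman bracket:
`T_I(u,v) = [Iu,Iv] - I([Iu,v] + [u,Iv] - I[u,v])`. -/
def torD (I : (g × Dual K g) →ₗ[K] (g × Dual K g)) (u v : g × Dual K g) :
    g × Dual K g :=
  dorf (I u) (I v) - I (dorf (I u) v + dorf u (I v) - I (dorf u v))

/-- `J_N (X, α) = (N X, -α ∘ N)`. -/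
def JN (N : g →ₗ[K] g) : (g × Dual K g) →ₗ[K] (g × Dual K g) :=
  LinearMap.prodMap N (-N.dualMap)

/-- `J_ω (X, α) = (0, ω♭ X)`. -/
def Jom (ω : g →ₗ[K] g →ₗ[K] K) : (g × Dual K g) →ₗ[K] (g × Dual K g) :=
  LinearMap.prod 0 (ω ∘ₗ LinearMap.fst K g (Dual K g))

/-- `J_π (X, α) = (π α, 0)`. -/
def Jpi (π : Dual K g →ₗ[K] g) : (g × Dual K g) →ₗ[K] (g × Dual K g) :=
  LinearMap.prod (π ∘ₗ LinearMap.snd K g (Dual K g)) 0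

/-- Deformation of a bracket on `g × g*` by an endomorphism. -/
def deformE (b : (g × Dual K g) → (g × Dual K g) → (g × Dual K g))
    (I : (g × Dual K g) →ₗ[K] (g × Dual K g)) :
    (g × Dual K g) → (g × Dual K g) → (g × Dual K g) :=
  fun u v => b (I u) v + b u (I v) - I (b u v)

/-- The Koszul bracket on `g*` associated to a bivector `θ`:
`[α,β]_θ = (Z ↦ α ⁅θβ, Z⁆ - β ⁅θα, Z⁆)`. -/
def koszul (θ : Dual K g →ₗ[K] g) (α β : Dual K g) : Dual K g :=
  α ∘ₗ adl (K := K) (θ β) - β ∘ₗ adl (K := K) (θ α)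

/-- Deforming the Dorfman bracket by `J_ω` gives zero when `ω` is closed. -/
lemma deformE_dorf_Jom_eq_zero (ω : g →ₗ[K] g →ₗ[K] K) (hAlt : ∀ X, ω X X = 0)
    (hcl : ∀ X Y Z : g, ω ⁅X, Y⁆ Z + ω ⁅Y, Z⁆ X + ω ⁅Z, X⁆ Y = 0)
    (u v : g × Dual K g) : deformE dorf (Jom ω) u v = 0 := by
  have hsk : ∀ X Y, ω X Y = -ω Y X := fun X Y => (LinearMap.IsAlt.neg hAlt Y X).symm
  refine Prod.ext ?_ (LinearMap.ext fun Z => ?_)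
  · simp [deformE, dorf, Jom]
  · have h := hcl u.1 v.1 Z
    rw [hsk ⁅v.1, Z⁆ u.1, hsk ⁅Z, u.1⁆ v.1, ← lie_skew Z u.1, map_neg] at h
    simp [deformE, dorf, Jom]
    linear_combination -h

/-- If `ω` is closed and `N` is self-adjoint for `ω`, deforming the Dorfman bracket by `J_N` and
then by `J_ω` gives `2 dω_N`. -/
lemma deformE_deformE_dorf_JN_Jom (ω : g →ₗ[K] g →ₗ[K] K) (hAlt : ∀ X, ω X X = 0)
    (hcl : ∀ X Y Z : g, ω ⁅X, Y⁆ Z + ω ⁅Y, Z⁆ X + ω ⁅Z, X⁆ Y = 0)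
    (N : g →ₗ[K] g) (hN : ∀ X Y, ω (N X) Y = ω X (N Y)) (u v : g × Dual K g) :
    (deformE (deformE dorf (JN N)) (Jom ω) u v).1 = 0 ∧
      ∀ Z, (deformE (deformE dorf (JN N)) (Jom ω) u v).2 Z =
        2 * (ω (N ⁅u.1, v.1⁆) Z + ω (N ⁅v.1, Z⁆) u.1 + ω (N ⁅Z, u.1⁆) v.1) := by
  have hsk : ∀ X Y, ω X Y = -ω Y X := fun X Y => (LinearMap.IsAlt.neg hAlt Y X).symm
  constructor
  · simp [deformE, dorf, Jom, JN]
  · intro Z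
    obtain ⟨X, α⟩ := u
    obtain ⟨Y, β⟩ := v
    have h₁ := hcl (N X) Y Z
    have h₂ := hcl X (N Y) Z
    have h₃ := hcl X Y (N Z)
    rw [← hN, hsk ⁅Z, N X⁆ Y, ← lie_skew Z (N X), map_neg] at h₁
    rw [← hN, hsk ⁅N Y, Z⁆ X] at h₂
    rw [← hN, hsk ⁅Y, N Z⁆ X, hsk ⁅N Z, X⁆ Y, ← lie_skew (N Z) X, map_neg] at h₃
    have e₁ := hsk (N ⁅Y, Z⁆) X
    have e₂ := hsk (N ⁅Z, X⁆) Y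
    have e₃ : ω Y (N ⁅Z, X⁆) = -ω Y (N ⁅X, Z⁆) := by rw [← lie_skew Z X, map_neg, map_neg]
    simp [deformE, dorf, Jom, JN] at h₁ h₂ h₃ ⊢
    linear_combination -e₁ - e₂ - h₁ - h₂ - h₃ + e₃

/-- For a Poisson bivector `π`, a closed 2-form `ω` on `g` and `N = π ∘ ω♭`,
the pair `(π, ω)` is a PΩ structure iff `(J_ω, J_N)` is a compatible pair on
`g × g*`. -/
theorem pOmega_iff_compatible_pair (π : Dual K g →ₗ[K] g)
    (hskew : ∀ α β : Dual K g, α (π β) = -β (π α))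
    (hPoisson : ∀ α β γ : Dual K g, α ⁅π β, π γ⁆ + β ⁅π γ, π α⁆ + γ ⁅π α, π β⁆ = 0)
    (ω : g →ₗ[K] g →ₗ[K] K) (hAlt : ∀ X, ω X X = 0)
    (hcl : ∀ X Y Z : g, ω ⁅X, Y⁆ Z + ω ⁅Y, Z⁆ X + ω ⁅Z, X⁆ Y = 0)
    (N : g →ₗ[K] g) (hNdef : N = π ∘ₗ ω) :
    (∀ X Y Z : g, ω (N ⁅X, Y⁆) Z + ω (N ⁅Y, Z⁆) X + ω (N ⁅Z, X⁆) Y = 0) ↔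
      (Jom ω ∘ₗ JN N = -(JN N ∘ₗ Jom ω) ∧
        ∀ u v : g × Dual K g,
          deformE (deformE dorf (Jom ω)) (JN N) u v
            + deformE (deformE dorf (JN N)) (Jom ω) u v = 0) := by
  have hsk : ∀ X Y, ω X Y = -ω Y X := fun X Y => (LinearMap.IsAlt.neg hAlt Y X).symm
  have hN : ∀ X Y, ω (N X) Y = ω X (N Y) := by
    intro X Y
    subst hNdef
    rw [hsk]
    exact (hskew (ω X) (ω Y)).symm
  have hzero : deformE dorf (Jom ω) = fun _ _ => 0 := by
    funext u v
    exact deformE_dorf_Jom_eq_zero ω hAlt hcl u v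
  have hzero' : ∀ u v, deformE (deformE dorf (Jom ω)) (JN N) u v = 0 := by
    intro u v
    rw [hzero]
    simp [deformE]
  have hformula := deformE_deformE_dorf_JN_Jom ω hAlt hcl N hN
  simp only [hzero', zero_add]
  constructor
  · intro h
    refine ⟨?_, fun u v => Prod.ext (hformula u v).1 (LinearMap.ext fun Z => ?_)⟩
    · refine LinearMap.ext fun u => Prod.ext ?_ (LinearMap.ext fun Z => ?_)
      · simp [Jom, JN]
      · simp [Jom, JN, hN]
    · rw [(hformula u v).2 Z, h, mul_zero]
      rfl
  · rintro ⟨-, h⟩ X Y Z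
    have hXYZ := (hformula (X, 0) (Y, 0)).2 Z
    rw [h] at hXYZ
    exact (mul_eq_zero.mp hXYZ.symm).resolve_left two_ne_zero
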